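/- Let M = (m_ij) ∈ ℤ^{d×d} satisfy m_ii = 0, m_ik ≤ m_ij + m_jk for all i, j, k, and be in standard form (m_ij ≥ 0 for all i, j and m_ij + m_ji > 0 for i ≠ j), and let N, N' ∈ ℤ^{d×d} each satisfy the fractional-ideal inequalities n_ik ≤ n_ij + m_jk and n_ik ≤ m_ij + n_jk for all i, j, k. Then I_N · I_{N'} = I_{N ⊙ N'}, where I_N · I_{N'} is the set of finite sums of products XY with X ∈ I_N, Y ∈ I_{N'}, and (N ⊙ N')_ik = min_{1≤j≤d} (n_ij + n'_jk) is the min-plus matrix product. -/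

import Mathlib

set_option synthInstance.maxHeartbeats 400000
set_option maxHeartbeats 1600000

open scoped Pointwise

/-- The set `I_N = {X ∈ K^{d×d} : val(X) ≥ N}` (equal to `Λ_N` for suitable `N`). -/
def matSet {K : Type*} [Field K] (v : AddValuation K (WithTop ℤ)) {d : ℕ}
    (N : Matrix (Fin d) (Fin d) ℤ) : Set (Matrix (Fin d) (Fin d) K) :=
  {X | ∀ i j, (N i j : WithTop ℤ) ≤ v (X i j)}

theorem zero_mem_matSet {K : Type*} [Field K] (v : AddValuation K (WithTop ℤ)) {d : ℕ}
    (N : Matrix (Fin d) (Fin d) ℤ) : (0 : Matrix (Fin d) (Fin d) K) ∈ matSet v N :=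
  fun i j => by simp

theorem add_mem_matSet {K : Type*} [Field K] {v : AddValuation K (WithTop ℤ)} {d : ℕ}
    {N : Matrix (Fin d) (Fin d) ℤ} {X Y : Matrix (Fin d) (Fin d) K}
    (hX : X ∈ matSet v N) (hY : Y ∈ matSet v N) : X + Y ∈ matSet v N :=
  fun i j => v.map_le_add (hX i j) (hY i j)

theorem mul_mem_matSet {K : Type*} [Field K] {v : AddValuation K (WithTop ℤ)} {d : ℕ}
    {N N' P : Matrix (Fin d) (Fin d) ℤ} (hP : ∀ i j k, P i k ≤ N i j + N' j k)
    {X Y : Matrix (Fin d) (Fin d) K} (hX : X ∈ matSet v N) (hY : Y ∈ matSet v N') :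
    X * Y ∈ matSet v P := by
  intro i k
  rw [Matrix.mul_apply]
  refine v.map_le_sum fun j _ => ?_
  rw [v.map_mul]
  calc (P i k : WithTop ℤ) ≤ (N i j : WithTop ℤ) + (N' j k : WithTop ℤ) := by
        exact_mod_cast hP i j k
    _ ≤ v (X i j) + v (Y j k) := add_le_add (hX i j) (hY j k)

theorem single_mem_matSet {K : Type*} [Field K] {v : AddValuation K (WithTop ℤ)} {d : ℕ}
    {N : Matrix (Fin d) (Fin d) ℤ} {i j : Fin d} {a : K} (ha : (N i j : WithTop ℤ) ≤ v a) :
    Matrix.single i j a ∈ matSet v N := by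
  intro i' j'
  rw [Matrix.single_apply]
  split_ifs with h
  · obtain ⟨rfl, rfl⟩ := h
    exact ha
  · simp

/-- A scalar of valuation at least `m + n` is a product of scalars of valuations at least
`m` and `n`. -/
theorem exists_mul_eq_of_add_le {K : Type*} [Field K] {v : AddValuation K (WithTop ℤ)}
    (hv : Function.Surjective v) {m n : ℤ} {z : K}
    (hz : ((m + n : ℤ) : WithTop ℤ) ≤ v z) :
    ∃ a b : K, (m : WithTop ℤ) ≤ v a ∧ (n : WithTop ℤ) ≤ v b ∧ a * b = z := by
  obtain ⟨a, ha⟩ := hv m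
  have ha0 : a ≠ 0 := by
    rintro rfl
    simp at ha
  have hab : a * (a⁻¹ * z) = z := mul_inv_cancel_left₀ ha0 z
  refine ⟨a, a⁻¹ * z, ha.ge, ?_, hab⟩
  rw [← hab, v.map_mul, ha, WithTop.coe_add] at hz
  exact (WithTop.add_le_add_iff_left WithTop.coe_ne_top).1 hz

/-- For fractional-ideal matrices `N, N'` of a graduated order `Λ_M` in
standard form, the product `I_N · I_{N'}` (the set of finite sums of products `XY` with
`X ∈ I_N`, `Y ∈ I_{N'}`) equals `I_{N ⊙ N'}`, where `(N ⊙ N')_ik = min_j (n_ij + n'_jk)`. -/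
theorem ideal_product_eq_minplus_product {K : Type*} [Field K]
    (v : AddValuation K (WithTop ℤ)) (hv : Function.Surjective v)
    (d : ℕ) (hd : 0 < d)
    (M : Matrix (Fin d) (Fin d) ℤ) (hdiag : ∀ i, M i i = 0)
    (htri : ∀ i j k, M i k ≤ M i j + M j k)
    (hstd1 : ∀ i j, 0 ≤ M i j) (hstd2 : ∀ i j, i ≠ j → 0 < M i j + M j i)
    (N N' P : Matrix (Fin d) (Fin d) ℤ)
    (hN : ∀ i j k, N i k ≤ N i j + M j k ∧ N i k ≤ M i j + N j k)
    (hN' : ∀ i j k, N' i k ≤ N' i j + M j k ∧ N' i k ≤ M i j + N' j k)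
    (hP : ∀ i k, (∀ j, P i k ≤ N i j + N' j k) ∧ ∃ j, P i k = N i j + N' j k) :
    (AddSubmonoid.closure {Z : Matrix (Fin d) (Fin d) K |
        ∃ X ∈ matSet v N, ∃ Y ∈ matSet v N', Z = X * Y} :
      Set (Matrix (Fin d) (Fin d) K)) = matSet v P := by
  refine Set.Subset.antisymm (fun Z hZ => ?_) (fun Z hZ => ?_)
  · induction hZ using AddSubmonoid.closure_induction with
    | mem Z hZ =>
      obtain ⟨X, hX, Y, hY, rfl⟩ := hZ
      exact mul_mem_matSet (fun i j k => (hP i k).1 j) hX hY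
    | zero => exact zero_mem_matSet v P
    | add X Y _ _ hX hY => exact add_mem_matSet hX hY
  · rw [SetLike.mem_coe, Matrix.matrix_eq_sum_single Z]
    refine sum_mem fun i _ => sum_mem fun k _ => AddSubmonoid.subset_closure ?_
    obtain ⟨j, hj⟩ := (hP i k).2
    obtain ⟨a, b, ha, hb, hab⟩ := exists_mul_eq_of_add_le hv (hj ▸ hZ i k)
    exact ⟨_, single_mem_matSet ha, _, single_mem_matSet hb, by
      rw [Matrix.single_mul_single_same, hab]⟩
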